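/- Let a, γ, δ, α, β, q ∈ ℂ with a ∉ {0, −1} and γ not a nonpositive integer, and set λ = 0. Define A_n = ((1+a)/a) · (n² + ((α+β−δ+2λ+a(γ+δ−1+2λ))/(1+a)) n + (λ(α+β−δ+λ+a(γ+δ−1+λ))+q)/(1+a)) / (n² + (1+γ+2λ) n + (1+λ)(γ+λ)) and B_n = (−1/a) · (n² + (α+β−2+2λ) n + (α−1+λ)(β−1+λ)) / (n² + (γ+1+2λ) n + (1+λ)(γ+λ)), and let d_0 = 1, d_1 = A_0, d_{n+1} = A_n d_n + B_n d_{n−1} for n ≥ 1. Then for every x ∈ ℂ with |(1+a)/a| · |x| + |x|²/|a| < 1, the series ∑_{n=0}^{∞} d_n x^n converges absolutely. -/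

import Mathlib

open Filter Topology in
/-- The quotient of two monic quadratic polynomials tends to `1` along the natural numbers. -/
theorem tendsto_monic_quadratic_div (b c e f : ℂ) :
    Tendsto (fun n : ℕ => ((n : ℂ) ^ 2 + b * n + c) / ((n : ℂ) ^ 2 + e * n + f))
      atTop (𝓝 1) := by
  have hinv : Tendsto (fun n : ℕ => ((n : ℂ))⁻¹) atTop (𝓝 0) :=
    tendsto_inv_atTop_nhds_zero_nat (𝕜 := ℂ)
  have hpoly (u v : ℂ) :
      Tendsto (fun n : ℕ => 1 + u * (n : ℂ)⁻¹ + v * (n : ℂ)⁻¹ ^ 2) atTop (𝓝 1) := by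
    simpa using ((hinv.const_mul u).const_add 1).add ((hinv.pow 2).const_mul v)
  have hdiv := (hpoly b c).div (hpoly e f) one_ne_zero
  rw [div_one] at hdiv
  refine hdiv.congr' ?_
  filter_upwards [eventually_ne_atTop 0] with n hn
  have hn' : (n : ℂ) ≠ 0 := Nat.cast_ne_zero.mpr hn
  have hfactor (u v : ℂ) : (n : ℂ) ^ 2 + u * n + v =
      (n : ℂ) ^ 2 * (1 + u * (n : ℂ)⁻¹ + v * (n : ℂ)⁻¹ ^ 2) := by
    field_simp
  rw [Pi.div_apply, hfactor b c, hfactor e f, mul_div_mul_left _ _ (pow_ne_zero 2 hn')]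

/-- A nonnegative sequence with `u (n + 2) ≤ P * u (n + 1) + S * u n` and `P + S < 1`
is summable. -/
theorem summable_of_le_two_term {u : ℕ → ℝ} (hu : ∀ n, 0 ≤ u n) {P S : ℝ} (hP : 0 ≤ P)
    (hS : 0 ≤ S) (hPS : P + S < 1) (h : ∀ n, u (n + 2) ≤ P * u (n + 1) + S * u n) :
    Summable u := by
  refine summable_of_sum_range_le (c := (u 0 + u 1) / (1 - (P + S))) hu fun n => ?_
  rw [le_div_iff₀ (by linarith)]
  have hmono : ∑ i ∈ Finset.range n, u i ≤ ∑ i ∈ Finset.range (n + 2), u i := by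
    rw [Finset.sum_range_succ, Finset.sum_range_succ]
    linarith [hu n, hu (n + 1)]
  have hsplit : ∑ i ∈ Finset.range (n + 2), u i =
      ∑ i ∈ Finset.range n, u (i + 2) + u 1 + u 0 := by
    rw [Finset.sum_range_succ', Finset.sum_range_succ']
  have hshift : ∑ i ∈ Finset.range n, u (i + 1) ≤ ∑ i ∈ Finset.range (n + 2), u i := by
    rw [Finset.sum_range_succ', Finset.sum_range_succ]
    linarith [hu 0, hu (n + 1)]
  have hrec : ∑ i ∈ Finset.range n, u (i + 2) ≤
      P * ∑ i ∈ Finset.range n, u (i + 1) + S * ∑ i ∈ Finset.range n, u i := by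
    rw [Finset.mul_sum, Finset.mul_sum, ← Finset.sum_add_distrib]
    exact Finset.sum_le_sum fun i _ => h i
  nlinarith [mul_le_mul_of_nonneg_left hshift hP, mul_le_mul_of_nonneg_left hmono hS,
    mul_le_mul_of_nonneg_left hmono (sub_nonneg.mpr hPS.le)]

open Filter Topology in
/-- A nonnegative sequence satisfying a two-term recursive inequality whose coefficients
converge to limits with sum less than `1` is summable. -/
theorem summable_of_tendsto_two_term {u P S : ℕ → ℝ} {p s : ℝ} (hu : ∀ n, 0 ≤ u n)
    (hp : 0 ≤ p) (hs : 0 ≤ s) (hps : p + s < 1) (hP : Tendsto P atTop (𝓝 p))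
    (hS : Tendsto S atTop (𝓝 s)) (h : ∀ n, u (n + 2) ≤ P n * u (n + 1) + S n * u n) :
    Summable u := by
  obtain ⟨ε, hε, hεps⟩ : ∃ ε > 0, p + ε + (s + ε) < 1 :=
    ⟨(1 - (p + s)) / 4, by linarith, by linarith⟩
  obtain ⟨N, hN⟩ := eventually_atTop.mp
    ((hP.eventually_le_const (lt_add_of_pos_right p hε)).and
      (hS.eventually_le_const (lt_add_of_pos_right s hε)))
  rw [← summable_nat_add_iff N]
  refine summable_of_le_two_term (fun n => hu _) (by positivity) (by positivity) hεps fun n => ?_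
  obtain ⟨hPn, hSn⟩ := hN (n + N) (Nat.le_add_left N n)
  have hn := h (n + N)
  rw [show n + 2 + N = n + N + 2 by ring, show n + 1 + N = n + N + 1 by ring]
  linarith [mul_le_mul_of_nonneg_right hPn (hu (n + N + 1)),
    mul_le_mul_of_nonneg_right hSn (hu (n + N))]

/-- For the three-term recurrence coefficients of the local Heun function
around `x = 0` with indicial root `λ = 0`, the series `∑ d n * x^n` converges absolutely
for every `x` with `‖(1+a)/a‖ * ‖x‖ + ‖x‖² / ‖a‖ < 1`. -/
theorem stmt_1 (a γ δ α β q : ℂ) (ha0 : a ≠ 0) (ham1 : a ≠ -1)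
    (hγ : ∀ n : ℕ, γ ≠ -(n : ℂ))
    (lam : ℂ) (hlam : lam = 0)
    (A B : ℕ → ℂ)
    (hA : ∀ n : ℕ, A n = ((1 + a) / a) *
      (((n : ℂ) ^ 2 + ((α + β - δ + 2 * lam + a * (γ + δ - 1 + 2 * lam)) / (1 + a)) * n
          + (lam * (α + β - δ + lam + a * (γ + δ - 1 + lam)) + q) / (1 + a)) /
        ((n : ℂ) ^ 2 + (1 + γ + 2 * lam) * n + (1 + lam) * (γ + lam))))
    (hB : ∀ n : ℕ, B n = (-1 / a) *
      (((n : ℂ) ^ 2 + (α + β - 2 + 2 * lam) * n + (α - 1 + lam) * (β - 1 + lam)) /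
        ((n : ℂ) ^ 2 + (γ + 1 + 2 * lam) * n + (1 + lam) * (γ + lam))))
    (d : ℕ → ℂ) (hd0 : d 0 = 1) (hd1 : d 1 = A 0)
    (hd : ∀ n : ℕ, 1 ≤ n → d (n + 1) = A n * d n + B n * d (n - 1))
    (x : ℂ) (hx : ‖(1 + a) / a‖ * ‖x‖ + ‖x‖ ^ 2 / ‖a‖ < 1) :
    Summable (fun n : ℕ => ‖d n * x ^ n‖) := by
  have hAlim : Filter.Tendsto A Filter.atTop (nhds ((1 + a) / a)) := by
    rw [funext hA]
    simpa using (tendsto_monic_quadratic_div _ _ _ _).const_mul ((1 + a) / a)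
  have hBlim : Filter.Tendsto B Filter.atTop (nhds (-1 / a)) := by
    rw [funext hB]
    simpa using (tendsto_monic_quadratic_div _ _ _ _).const_mul (-1 / a)
  refine summable_of_tendsto_two_term (P := fun n => ‖A (n + 1)‖ * ‖x‖)
    (S := fun n => ‖B (n + 1)‖ * ‖x‖ ^ 2) (p := ‖(1 + a) / a‖ * ‖x‖)
    (s := ‖-1 / a‖ * ‖x‖ ^ 2) (fun n => norm_nonneg _) (by positivity) (by positivity) ?_
    (((Filter.tendsto_add_atTop_iff_nat 1).mpr hAlim).norm.mul_const _)
    (((Filter.tendsto_add_atTop_iff_nat 1).mpr hBlim).norm.mul_const _) fun n => ?_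
  · convert hx using 2
    rw [norm_div, norm_neg, norm_one, one_div, inv_mul_eq_div]
  · have hrec := hd (n + 1) (Nat.le_add_left 1 n)
    rw [Nat.add_sub_cancel] at hrec
    rw [show d (n + 2) * x ^ (n + 2) = A (n + 1) * x * (d (n + 1) * x ^ (n + 1)) +
      B (n + 1) * x ^ 2 * (d n * x ^ n) by rw [hrec]; ring]
    refine (norm_add_le _ _).trans_eq ?_
    simp only [norm_mul, norm_pow]
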